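/- Let M be the magma on the eight-element set {0, 1, 2, H, C, C̄, D, D̄} whose multiplication is given by: 1·C = C, 1·C̄ = C̄, 2·D = D, 2·D̄ = D̄, H·C = D, H·C̄ = D̄, and x·y = 0 for every other pair (x, y). For n ∈ ℕ and x : Fin n → M, y ∈ M define the nested product t_n(x, y) := x 0 · (x 1 · (x 2 · ( ⋯ · (x (n−1) · (x 0 · y)) ⋯ ))). Then for every n > 3, every i with 0 < i < n − 2, every x : Fin n → M and every y ∈ M, one has t_n(x, y) = t_n(x ∘ σ, y), where σ is the transposition of Fin n swapping i and i+1. -/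

import Mathlib

namespace Stmt19

/-- The eight-element set {0, 1, 2, H, C, C̄, D, D̄}. -/
inductive M8 : Type
  | zero | one | two | H | C | Cbar | D | Dbar
  deriving DecidableEq

/-- The multiplication: 1·C = C, 1·C̄ = C̄, 2·D = D, 2·D̄ = D̄, H·C = D, H·C̄ = D̄,
and every other product is 0. -/
def M8.mul : M8 → M8 → M8
  | .one, .C => .C
  | .one, .Cbar => .Cbar
  | .two, .D => .D
  | .two, .Dbar => .Dbar
  | .H, .C => .D
  | .H, .Cbar => .Dbar
  | _, _ => .zero

instance : Mul M8 := ⟨M8.mul⟩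

/-- The nested product `t_n(x, y) = x 0 · (x 1 · ( ⋯ · (x (n−1) · (x 0 · y)) ⋯ ))`. -/
def tprod : {n : ℕ} → (Fin n → M8) → M8 → M8
  | 0, _, y => y
  | _ + 1, x, y => List.foldr (· * ·) (x 0 * y) (List.ofFn x)

/-- Invariant of the inner fold. -/
def Inv (a y : M8) (l : List M8) (z : M8) : Prop :=
  match a with
  | .one => (z = .one * y ∧ ∀ b ∈ l, b = .one) ∨
      ((∃ b ∈ l, b ≠ .one) ∧ (z = .zero ∨ z = .D ∨ z = .Dbar))
  | .two => (z = .two * y ∧ ∀ b ∈ l, b = .two) ∨ ((∃ b ∈ l, b ≠ .two) ∧ z = .zero)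
  | .H => z = .zero ∨ z = .D ∨ z = .Dbar
  | _ => z = .zero

theorem inv_foldr (a y : M8) (l : List M8) :
    Inv a y l (List.foldr (· * ·) (a * y) l) := by
  induction l with
  | nil => cases a <;> cases y <;> simp [Inv] <;> decide
  | cons b l ih =>
    rw [List.foldr_cons]
    generalize List.foldr (· * ·) (a * y) l = z at ih
    have hz : ∀ b : M8, b * .zero = .zero := by intro b; cases b <;> rfl
    have hD : ∀ b : M8, b * .D = .zero ∨ b * .D = .D := by intro b; cases b <;> decide
    have hD' : ∀ b : M8, b * .Dbar = .zero ∨ b * .Dbar = .Dbar := by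
      intro b; cases b <;> decide
    have hk : ∀ z : M8, (z = .zero ∨ z = .D ∨ z = .Dbar) →
        (b * z = .zero ∨ b * z = .D ∨ b * z = .Dbar) := by
      rintro z (rfl | rfl | rfl)
      · exact Or.inl (hz b)
      · have := hD b; tauto
      · have := hD' b; tauto
    cases a <;> simp only [Inv] at ih ⊢
    case one =>
      rcases ih with ⟨rfl, h⟩ | ⟨⟨c, hc, hne⟩, h⟩
      · by_cases hb : b = .one
        · subst hb
          left
          exact ⟨by cases y <;> rfl, by simpa using h⟩
        · right
          refine ⟨⟨b, by simp, hb⟩, ?_⟩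
          cases b <;> first | exact absurd rfl hb | (cases y <;> decide)
      · right
        exact ⟨⟨c, by simp [hc], hne⟩, hk z h⟩
    case two =>
      rcases ih with ⟨rfl, h⟩ | ⟨⟨c, hc, hne⟩, h⟩
      · by_cases hb : b = .two
        · subst hb
          left
          exact ⟨by cases y <;> rfl, by simpa using h⟩
        · right
          refine ⟨⟨b, by simp, hb⟩, ?_⟩
          cases b <;> first | exact absurd rfl hb | (cases y <;> decide)
      · right
        exact ⟨⟨c, by simp [hc], hne⟩, by rw [h]; exact hz b⟩
    case H => exact hk z ih
    all_goals (rw [ih]; exact hz b)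

theorem foldr_eq_zero (a y : M8) (l : List M8) (h : ∃ b ∈ l, b ≠ a) :
    a * List.foldr (· * ·) (a * y) l = .zero := by
  have ih := inv_foldr a y l
  generalize List.foldr (· * ·) (a * y) l = z at ih
  obtain ⟨b, hb, hne⟩ := h
  cases a <;> simp only [Inv] at ih
  case one =>
    rcases ih with ⟨_, h⟩ | ⟨_, rfl | rfl | rfl⟩
    · exact absurd (h b hb) hne
    all_goals rfl
  case two =>
    rcases ih with ⟨_, h⟩ | ⟨_, rfl⟩
    · exact absurd (h b hb) hne
    · rfl
  case H => rcases ih with rfl | rfl | rfl <;> rfl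
  all_goals (subst ih; rfl)

theorem tprod_eq_zero {m : ℕ} (x : Fin (m + 1) → M8) (y : M8) (j : Fin (m + 1))
    (h : x j ≠ x 0) : tprod x y = .zero := by
  simp only [tprod, List.ofFn_succ, List.foldr_cons]
  apply foldr_eq_zero
  cases j using Fin.cases with
  | zero => exact absurd rfl h
  | succ k => exact ⟨x k.succ, by simp [List.mem_ofFn], h⟩

theorem stmt19 (n : ℕ) (hn : 3 < n) (i : ℕ) (hi0 : 0 < i) (hi : i < n - 2)
    (x : Fin n → M8) (y : M8) :
    tprod x y =
      tprod (x ∘ Equiv.swap (⟨i, by omega⟩ : Fin n) (⟨i + 1, by omega⟩ : Fin n)) y := by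
  obtain ⟨m, rfl⟩ : ∃ m, n = m + 1 := ⟨n - 1, by omega⟩
  set σ := Equiv.swap (⟨i, by omega⟩ : Fin (m + 1)) (⟨i + 1, by omega⟩ : Fin (m + 1)) with hσ
  have h0 : σ 0 = 0 := by
    apply Equiv.swap_apply_of_ne_of_ne
    · intro h; have := congrArg Fin.val h; simp at this; omega
    · intro h; have := congrArg Fin.val h; simp at this
  by_cases h : ∀ j, x j = x 0
  · have : x ∘ σ = x := by
      funext j
      rw [Function.comp_apply, h (σ j), h j]
    rw [this]
  · push Not at h
    obtain ⟨j, hj⟩ := h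
    rw [tprod_eq_zero x y j hj, tprod_eq_zero (x ∘ σ) y (σ.symm j) (by simpa [h0] using hj)]

end Stmt19
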